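/- Let d ≥ 1 be an integer and let q > 1 be a real number with d(q − 1) < 2q. There exist θ ∈ (0, 1) and a constant C > 0, both depending only on d and q, such that for every ε > 0 and every continuously differentiable function ψ : ℝ^d → ℝ with compact support, ‖ψ² ∗ p_ε − ψ²‖_q ≤ C ε^{θ/2} ‖∇ψ‖₂^{2−θ} ‖ψ‖₂^{θ}; in particular ‖ψ² ∗ p_ε − ψ²‖_q ≤ C ε^{θ/2} (‖∇ψ‖₂² + ‖ψ‖₂²). -/

import Mathlib

open Real MeasureTheory

/-- The Gaussian heat kernel `p_ε(x) = (2πε)^{-d/2} exp(-|x|²/(2ε))` on `ℝ^d`. -/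
noncomputable def heatKernel (d : ℕ) (ε : ℝ) (x : EuclideanSpace ℝ (Fin d)) : ℝ :=
  (2 * Real.pi * ε) ^ (-(d : ℝ) / 2) * Real.exp (-‖x‖ ^ 2 / (2 * ε))

/-- Convolution of `f` with the Gaussian heat kernel `p_ε`. -/
noncomputable def heatConv (d : ℕ) (ε : ℝ) (f : EuclideanSpace ℝ (Fin d) → ℝ)
    (x : EuclideanSpace ℝ (Fin d)) : ℝ :=
  ∫ y, heatKernel d ε (x - y) * f y

/-- The `L^r` norm (w.r.t. Lebesgue measure) of `f : ℝ^d → ℝ`. -/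
noncomputable def Lnorm (d : ℕ) (r : ℝ) (f : EuclideanSpace ℝ (Fin d) → ℝ) : ℝ :=
  (∫ x, |f x| ^ r) ^ (1 / r)

/-- The `L²` norm of the gradient of `ψ : ℝ^d → ℝ`. -/
noncomputable def gradNorm2 (d : ℕ) (ψ : EuclideanSpace ℝ (Fin d) → ℝ) : ℝ :=
  (∫ x, ‖fderiv ℝ ψ x‖ ^ 2) ^ (1 / (2 : ℝ))

open scoped ENNReal NNReal

theorem lintegral_rpow_interpolate {α : Type*} [MeasurableSpace α] {μ : Measure α} {f : α → ℝ≥0∞}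
    (hf : AEMeasurable f μ) {s r a b p : ℝ} (hs : 0 ≤ s) (hr : 0 ≤ r) (ha : 0 ≤ a) (hb : 0 ≤ b)
    (hab : a + b = 1) (hp : p = s * a + r * b) :
    ∫⁻ x, f x ^ p ∂μ ≤ (∫⁻ x, f x ^ s ∂μ) ^ a * (∫⁻ x, f x ^ r ∂μ) ^ b := by
  refine le_trans (le_of_eq (lintegral_congr fun x => ?_))
    (ENNReal.lintegral_mul_norm_pow_le (hf.pow_const s) (hf.pow_const r) ha hb hab)
  rw [hp, ENNReal.rpow_add_of_nonneg _ _ (by positivity) (by positivity), ENNReal.rpow_mul,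
    ENNReal.rpow_mul]

theorem lintegral_mul_le_sqrt_mul_sqrt {α : Type*} [MeasurableSpace α] {μ : Measure α}
    {f g : α → ℝ≥0∞} (hf : AEMeasurable f μ) (hg : AEMeasurable g μ) :
    ∫⁻ x, f x * g x ∂μ ≤
      (∫⁻ x, f x ^ (2 : ℝ) ∂μ) ^ (1 / 2 : ℝ) * (∫⁻ x, g x ^ (2 : ℝ) ∂μ) ^ (1 / 2 : ℝ) :=
  ENNReal.lintegral_mul_le_Lp_mul_Lq μ Real.HolderConjugate.two_two hf hg

theorem lintegral_enorm_fderiv_pow_le {E : Type*} [NormedAddCommGroup E] [NormedSpace ℝ E]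
    [MeasurableSpace E] [BorelSpace E] {μ : Measure E} {u : E → ℝ} (hu : ContDiff ℝ 1 u) (k : ℕ) :
    ∫⁻ x, ‖fderiv ℝ (fun y => u y ^ (k + 1)) x‖ₑ ∂μ ≤ (k + 1 : ℕ) *
      ((∫⁻ x, ‖u x‖ₑ ^ (2 * k : ℝ) ∂μ) ^ (1 / 2 : ℝ) *
        (∫⁻ x, ‖fderiv ℝ u x‖ₑ ^ (2 : ℝ) ∂μ) ^ (1 / 2 : ℝ)) := by
  have hm : Measurable fun x => ‖u x‖ₑ ^ k := (hu.continuous.measurable.enorm).pow_const k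
  have hm' : Measurable fun x => ‖fderiv ℝ u x‖ₑ :=
    (hu.continuous_fderiv one_ne_zero).enorm.measurable
  have h1 : ∀ x, ‖fderiv ℝ (fun y => u y ^ (k + 1)) x‖ₑ =
      (k + 1 : ℕ) * (‖u x‖ₑ ^ k * ‖fderiv ℝ u x‖ₑ) := by
    intro x
    have hd : HasFDerivAt u (fderiv ℝ u x) x := (hu.differentiable one_ne_zero x).hasFDerivAt
    rw [(hd.pow (k + 1)).fderiv]
    simp only [add_tsub_cancel_right, nsmul_eq_mul, enorm_smul, enorm_mul, enorm_pow,
      mul_assoc]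
    congr 1
    rw [← ofReal_norm, Real.norm_natCast, ENNReal.ofReal_natCast]
  simp_rw [h1]
  rw [lintegral_const_mul (f := fun x => ‖u x‖ₑ ^ k * ‖fderiv ℝ u x‖ₑ) _ (hm.mul hm')]
  gcongr
  refine (lintegral_mul_le_sqrt_mul_sqrt hm.aemeasurable hm'.aemeasurable).trans (le_of_eq ?_)
  congr 3
  ext x
  rw [← ENNReal.rpow_natCast, ← ENNReal.rpow_mul, mul_comm]

theorem hasCompactSupport_pow {E : Type*} [TopologicalSpace E] {u : E → ℝ}
    (hu : HasCompactSupport u) (k : ℕ) : HasCompactSupport fun y => u y ^ (k + 1) :=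
  hu.comp_left (g := fun y : ℝ => y ^ (k + 1)) (by simp)

/-- The Gagliardo–Nirenberg inequality at exponent `2 * q`. -/
def GagliardoNirenberg (d : ℕ) (q : ℝ) : Prop :=
  ∃ C : ℝ≥0, ∀ u : EuclideanSpace ℝ (Fin d) → ℝ, ContDiff ℝ 1 u → HasCompactSupport u →
    ∫⁻ x, ‖u x‖ₑ ^ (2 * q) ≤ C * (∫⁻ x, ‖u x‖ₑ ^ (2 : ℝ)) ^ (q - d * (q - 1) / 2) *
      (∫⁻ x, ‖fderiv ℝ u x‖ₑ ^ (2 : ℝ)) ^ (d * (q - 1) / 2)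

theorem enorm_le_lintegral_fderiv_of_one {u : EuclideanSpace ℝ (Fin 1) → ℝ}
    (hu : ContDiff ℝ 1 u) (h2u : HasCompactSupport u) (x : EuclideanSpace ℝ (Fin 1)) :
    ‖u x‖ₑ ≤ ∫⁻ y, ‖fderiv ℝ u y‖ₑ := by
  let e := (OrthonormalBasis.singleton (Fin 1) ℝ).repr
  obtain ⟨t, rfl⟩ := e.surjective x
  have h := HasCompactSupport.enorm_le_lintegral_Ici_deriv (f := u ∘ e)
    (hu.comp e.toContinuousLinearEquiv.contDiff) (h2u.comp_homeomorph e.toHomeomorph) t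
  refine h.trans <| (setLIntegral_le_lintegral _ _).trans ?_
  rw [← e.measurePreserving.lintegral_comp_emb e.toHomeomorph.measurableEmbedding]
  refine lintegral_mono fun s => ?_
  have hd : HasFDerivAt u (fderiv ℝ u (e s)) (e s) :=
    (hu.differentiable one_ne_zero _).hasFDerivAt
  have he : HasDerivAt e (e 1) s := by
    simpa using! (e.toContinuousLinearEquiv.toContinuousLinearMap.hasDerivAt (x := s))
  rw [(hd.comp_hasDerivAt s he).deriv]
  refine (ContinuousLinearMap.le_opENorm _ _).trans ?_
  have hn : ‖e 1‖ = 1 := (e.norm_map 1).trans norm_one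
  rw [← ofReal_norm (e 1), hn, ENNReal.ofReal_one, mul_one]
  exact le_rfl

theorem gagliardoNirenberg_one {q : ℝ} (hq : 1 < q) : GagliardoNirenberg 1 q := by
  refine ⟨2 ^ (q - 1), fun u hu h2u => ?_⟩
  have hq' : 0 < q - 1 := by linarith
  set a := ∫⁻ x, ‖u x‖ₑ ^ (2 : ℝ) with ha
  set b := ∫⁻ x, ‖fderiv ℝ u x‖ₑ ^ (2 : ℝ) with hb
  have hsup : ∀ x, ‖u x‖ₑ ^ (2 : ℝ) ≤ 2 * (a ^ (1 / 2 : ℝ) * b ^ (1 / 2 : ℝ)) := by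
    intro x
    have h1 := enorm_le_lintegral_fderiv_of_one (u := fun y => u y ^ (1 + 1)) (hu.pow _)
      (hasCompactSupport_pow h2u 1) x
    have h2 := h1.trans (lintegral_enorm_fderiv_pow_le hu 1)
    rw [enorm_pow] at h2
    rw [ha, hb]
    norm_num at h2 ⊢
    exact h2
  calc ∫⁻ x, ‖u x‖ₑ ^ (2 * q)
      = ∫⁻ x, (‖u x‖ₑ ^ (2 : ℝ)) ^ (q - 1) * ‖u x‖ₑ ^ (2 : ℝ) := by
        refine lintegral_congr fun x => ?_
        rw [← ENNReal.rpow_mul, ← ENNReal.rpow_add_of_nonneg _ _ (by positivity) (by norm_num)]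
        ring_nf
    _ ≤ ∫⁻ x, (2 * (a ^ (1 / 2 : ℝ) * b ^ (1 / 2 : ℝ))) ^ (q - 1) * ‖u x‖ₑ ^ (2 : ℝ) := by
        gcongr with x
        exact hsup x
    _ = (2 * (a ^ (1 / 2 : ℝ) * b ^ (1 / 2 : ℝ))) ^ (q - 1) * a := by
        rw [lintegral_const_mul _ (hu.continuous.measurable.enorm.pow_const _)]
    _ = _ := by
        have : q - ((1 : ℕ) : ℝ) * (q - 1) / 2 = 1 / 2 * (q - 1) + 1 := by push_cast; ring
        rw [this, ENNReal.rpow_add_of_nonneg _ _ (by positivity) (by norm_num),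
          ENNReal.mul_rpow_of_nonneg _ _ hq'.le, ENNReal.mul_rpow_of_nonneg _ _ hq'.le,
          ← ENNReal.rpow_mul, ← ENNReal.rpow_mul, ENNReal.rpow_one,
          ENNReal.coe_rpow_of_nonneg _ hq'.le]
        push_cast
        ring_nf

theorem lintegral_even_pow_le_of_two (k : ℕ) :
    ∃ C : ℝ≥0, ∀ u : EuclideanSpace ℝ (Fin 2) → ℝ, ContDiff ℝ 1 u → HasCompactSupport u →
      ∫⁻ x, ‖u x‖ₑ ^ (2 * (k + 1 : ℕ) : ℝ) ≤ C * (∫⁻ x, ‖u x‖ₑ ^ (2 : ℝ)) *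
        (∫⁻ x, ‖fderiv ℝ u x‖ₑ ^ (2 : ℝ)) ^ k := by
  induction k with
  | zero => exact ⟨1, fun u _ _ => by simp⟩
  | succ k ih =>
    obtain ⟨C, hC⟩ := ih
    let K := eLpNormLESNormFDerivOneConst
      (volume : Measure (EuclideanSpace ℝ (Fin 2))) 2
    refine ⟨K ^ 2 * (k + 2) ^ 2 * C, fun u hu h2u => ?_⟩
    have h1 := eLpNorm_le_eLpNorm_fderiv_one (volume : Measure (EuclideanSpace ℝ (Fin 2)))
      (u := fun y => u y ^ (k + 1 + 1)) (hu.pow _)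
      (hasCompactSupport_pow h2u (k + 1)) (p := 2)
      (by
        rw [NNReal.holderConjugate_iff]
        norm_num)
    rw [eLpNorm_one_eq_lintegral_enorm] at h1
    have h2 := h1.trans (mul_le_mul_right (lintegral_enorm_fderiv_pow_le hu (k + 1)) _)
    have h3 := pow_le_pow_left₀ zero_le h2 2
    have hl : eLpNorm (fun y => u y ^ (k + 1 + 1)) (2 : ℝ≥0) volume ^ 2 =
        ∫⁻ x, ‖u x‖ₑ ^ (2 * (k + 1 + 1 : ℕ) : ℝ) := by
      rw [← ENNReal.rpow_natCast, Nat.cast_ofNat,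
        show (2 : ℝ) = ((2 : ℝ≥0) : ℝ) by norm_num, eLpNorm_nnreal_pow_eq_lintegral (by norm_num)]
      refine lintegral_congr fun x => ?_
      rw [enorm_pow, ← ENNReal.rpow_natCast, ← ENNReal.rpow_mul, mul_comm]
    have hs : ∀ t : ℝ≥0∞, (t ^ (1 / 2 : ℝ)) ^ 2 = t := fun t => by
      rw [← ENNReal.rpow_natCast, ← ENNReal.rpow_mul]; norm_num
    rw [hl] at h3
    simp only [mul_pow, hs] at h3
    refine h3.trans ?_
    grw [hC u hu h2u]
    push_cast
    refine le_of_eq ?_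
    ring

theorem gagliardoNirenberg_two {q : ℝ} (hq : 1 < q) : GagliardoNirenberg 2 q := by
  obtain ⟨k, hk⟩ := exists_nat_gt (q - 1)
  have hk0 : (0 : ℝ) < k := by linarith
  obtain ⟨C, hC⟩ := lintegral_even_pow_le_of_two k
  have hβ : 0 ≤ (q - 1) / k := div_nonneg (by linarith) hk0.le
  refine ⟨C ^ ((q - 1) / k), fun u hu h2u => ?_⟩
  have hα : 0 ≤ 1 - (q - 1) / k := sub_nonneg.2 ((div_le_one hk0).2 hk.le)
  refine (lintegral_rpow_interpolate (s := 2) (r := 2 * (k + 1 : ℕ)) (a := 1 - (q - 1) / k)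
    (b := (q - 1) / k) hu.continuous.measurable.enorm.aemeasurable (by norm_num) (by positivity)
    hα hβ (by ring) (by push_cast; field_simp; ring)).trans ?_
  grw [hC u hu h2u]
  rw [ENNReal.mul_rpow_of_nonneg _ _ hβ, ENNReal.mul_rpow_of_nonneg _ _ hβ,
    ← ENNReal.rpow_natCast, ← ENNReal.rpow_mul, ENNReal.coe_rpow_of_nonneg _ hβ]
  have e1 : q - ((2 : ℕ) : ℝ) * (q - 1) / 2 = (1 - (q - 1) / k) + (q - 1) / k := by
    push_cast; ring
  have e2 : ((2 : ℕ) : ℝ) * (q - 1) / 2 = k * ((q - 1) / k) := by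
    push_cast; field_simp
  rw [e1, e2, ENNReal.rpow_add_of_nonneg _ _ hα hβ]
  refine le_of_eq ?_
  ring

theorem gagliardoNirenberg_of_two_lt {d : ℕ} (hd : 2 < d) {q : ℝ} (hq : 1 < q)
    (hsub : (d : ℝ) * (q - 1) < 2 * q) : GagliardoNirenberg d q := by
  have hd' : (2 : ℝ) < d := by exact_mod_cast hd
  have hd2 : (0 : ℝ) < d - 2 := by linarith
  have hr0 : 0 < 2 * (d : ℝ) / (d - 2) := by positivity
  let r : ℝ≥0 := ⟨2 * (d : ℝ) / (d - 2), hr0.le⟩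
  have hr : (r : ℝ) = 2 * (d : ℝ) / (d - 2) := rfl
  have hrne : r ≠ 0 := fun h => hr0.ne' (by rw [← hr, h]; rfl)
  let K := SNormLESNormFDerivOfEqConst ℝ
    (volume : Measure (EuclideanSpace ℝ (Fin d))) ((2 : ℝ≥0) : ℝ)
  set β := (q - 1) * (d - 2) / 2 with hβdef
  have hq1 : 0 < q - 1 := by linarith
  have hβ : 0 ≤ β := by positivity
  have hα : 0 ≤ 1 - β := by rw [hβdef]; nlinarith
  refine ⟨(K ^ (r : ℝ)) ^ β, fun u hu h2u => ?_⟩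
  have h1 := eLpNorm_le_eLpNorm_fderiv_of_eq (volume : Measure (EuclideanSpace ℝ (Fin d)))
    hu h2u (p := 2) (p' := r) (by norm_num) (by simp; omega) (by
      rw [hr]
      simp only [finrank_euclideanSpace, Fintype.card_fin]
      push_cast
      field_simp)
  have h2 := ENNReal.rpow_le_rpow h1 (NNReal.coe_nonneg r)
  rw [eLpNorm_nnreal_pow_eq_lintegral hrne, ENNReal.mul_rpow_of_nonneg _ _ (NNReal.coe_nonneg r),
    eLpNorm_nnreal_eq_lintegral (by norm_num), ← ENNReal.rpow_mul] at h2
  refine (lintegral_rpow_interpolate (s := 2) (r := r) (a := 1 - β)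
    (b := β) hu.continuous.measurable.enorm.aemeasurable (by norm_num) (by positivity)
    hα hβ (by ring) (by rw [hr, hβdef]; field_simp; ring)).trans ?_
  grw [h2]
  rw [ENNReal.mul_rpow_of_nonneg _ _ hβ, ← ENNReal.rpow_mul, ← ENNReal.rpow_mul,
    ENNReal.coe_rpow_of_nonneg _ hβ, ENNReal.coe_rpow_of_nonneg _ (NNReal.coe_nonneg r),
    ← ENNReal.rpow_mul _ (r : ℝ) β]
  have e1 : q - (d : ℝ) * (q - 1) / 2 = 1 - β := by rw [hβdef]; ring
  have e2 : (d : ℝ) * (q - 1) / 2 = 1 / ((2 : ℝ≥0) : ℝ) * r * β := by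
    rw [hr, hβdef]; push_cast; field_simp
  rw [e1, e2]
  refine le_of_eq ?_
  simp only [NNReal.coe_ofNat, K]
  ring

theorem gagliardoNirenberg {d : ℕ} (hd : 1 ≤ d) {q : ℝ} (hq : 1 < q)
    (hsub : (d : ℝ) * (q - 1) < 2 * q) : GagliardoNirenberg d q := by
  rcases (by omega : d = 1 ∨ d = 2 ∨ 2 < d) with rfl | rfl | h
  · exact gagliardoNirenberg_one hq
  · exact gagliardoNirenberg_two hq
  · exact gagliardoNirenberg_of_two_lt h hq hsub

theorem lintegral_weight_mul_rpow_le {α : Type*} [MeasurableSpace α] {μ : Measure α}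
    {w g : α → ℝ≥0∞} (hw : AEMeasurable w μ) (hg : AEMeasurable g μ) (hw1 : ∫⁻ x, w x ∂μ = 1)
    {q : ℝ} (hq : 1 ≤ q) : (∫⁻ x, w x * g x ∂μ) ^ q ≤ ∫⁻ x, w x * g x ^ q ∂μ := by
  have hq0 : 0 < q := by linarith
  have hq1 : 0 ≤ 1 - q⁻¹ := sub_nonneg.2 (inv_le_one_of_one_le₀ hq)
  have h := ENNReal.lintegral_mul_norm_pow_le (hw.mul (hg.pow_const q)) hw
    (inv_nonneg.2 hq0.le) hq1 (by ring)
  rw [hw1, ENNReal.one_rpow, mul_one] at h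
  have h' : ∫⁻ x, w x * g x ∂μ ≤ (∫⁻ x, w x * g x ^ q ∂μ) ^ q⁻¹ := by
    refine le_trans (le_of_eq (lintegral_congr fun x => ?_)) h
    simp only [Pi.mul_apply]
    rw [ENNReal.mul_rpow_of_nonneg _ _ (inv_nonneg.2 hq0.le), ENNReal.rpow_rpow_inv hq0.ne',
      mul_right_comm, ← ENNReal.rpow_add_of_nonneg _ _ (inv_nonneg.2 hq0.le) hq1,
      add_sub_cancel, ENNReal.rpow_one]
  calc _ ≤ ((∫⁻ x, w x * g x ^ q ∂μ) ^ q⁻¹) ^ q := ENNReal.rpow_le_rpow h' hq0.le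
    _ = _ := ENNReal.rpow_inv_rpow hq0.ne' _

theorem lintegral_rpow_two_le_of_le_add {α : Type*} [MeasurableSpace α] {μ : Measure α}
    {h f g : α → ℝ≥0∞} (hf : Measurable f) (hle : ∀ x, h x ≤ f x + g x) :
    ∫⁻ x, h x ^ (2 : ℝ) ∂μ ≤ 2 * (∫⁻ x, f x ^ (2 : ℝ) ∂μ + ∫⁻ x, g x ^ (2 : ℝ) ∂μ) := by
  rw [← lintegral_add_left (hf.pow_const _), ← lintegral_const_mul' _ _ (by simp)]
  refine lintegral_mono fun x => ?_
  refine (ENNReal.rpow_le_rpow (hle x) (by norm_num)).trans ?_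
  refine (ENNReal.rpow_add_le_mul_rpow_add_rpow (f x) (g x) (p := 2) (by norm_num)).trans ?_
  norm_num

theorem enorm_comp_sub_sub_le {E : Type*} [NormedAddCommGroup E] [NormedSpace ℝ E] {u : E → ℝ}
    (hu : ContDiff ℝ 1 u) (x y : E) :
    ‖u (x - y) - u x‖ₑ ≤ ∫⁻ t in Set.Ioc (0 : ℝ) 1, ‖fderiv ℝ u (x - t • y)‖ₑ * ‖y‖ₑ := by
  have hc : Continuous fun t : ℝ => fderiv ℝ u (x - t • y) (-y) :=
    ((hu.continuous_fderiv one_ne_zero).comp (by fun_prop)).clm_apply continuous_const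
  have h := intervalIntegral.integral_eq_sub_of_hasDerivAt (a := 0) (b := 1)
    (f := fun t : ℝ => u (x - t • y)) (f' := fun t => fderiv ℝ u (x - t • y) (-y))
    (fun t _ => by
      have hl : HasDerivAt (fun t : ℝ => x - t • y) (-y) t := by
        simpa using ((hasDerivAt_id t).smul_const y).const_sub x
      exact ((hu.differentiable one_ne_zero (x - t • y)).hasFDerivAt.comp_hasDerivAt t hl))
    (hc.intervalIntegrable _ _)
  simp only [one_smul, zero_smul, sub_zero] at h
  rw [← h, intervalIntegral.integral_of_le zero_le_one]
  refine (enorm_integral_le_lintegral_enorm _).trans (lintegral_mono fun t => ?_)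
  simpa using (fderiv ℝ u (x - t • y)).le_opENorm (-y)

theorem lintegral_enorm_comp_sub_sub_le {E : Type*} [NormedAddCommGroup E] [NormedSpace ℝ E]
    [FiniteDimensional ℝ E] [MeasurableSpace E] [BorelSpace E] {μ : Measure E}
    [μ.IsAddHaarMeasure] {u : E → ℝ} (hu : ContDiff ℝ 1 u) (y : E) :
    ∫⁻ x, ‖u (x - y) - u x‖ₑ ^ (2 : ℝ) ∂μ ≤
      ‖y‖ₑ ^ (2 : ℝ) * ∫⁻ x, ‖fderiv ℝ u x‖ₑ ^ (2 : ℝ) ∂μ := by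
  have hc : Continuous fun p : E × ℝ => ‖fderiv ℝ u (p.1 - p.2 • y)‖ₑ :=
    ((hu.continuous_fderiv one_ne_zero).comp (by fun_prop)).enorm
  have hm : Measurable fun p : E × ℝ => (‖fderiv ℝ u (p.1 - p.2 • y)‖ₑ * ‖y‖ₑ) ^ (2 : ℝ) :=
    (hc.measurable.mul_const _).pow_const _
  calc ∫⁻ x, ‖u (x - y) - u x‖ₑ ^ (2 : ℝ) ∂μ
      ≤ ∫⁻ x, (∫⁻ t in Set.Ioc (0 : ℝ) 1,
          (‖fderiv ℝ u (x - t • y)‖ₑ * ‖y‖ₑ) ^ (2 : ℝ)) ∂μ := by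
        refine lintegral_mono fun x => ?_
        have hx : Continuous fun t : ℝ => ‖fderiv ℝ u (x - t • y)‖ₑ :=
          ((hu.continuous_fderiv one_ne_zero).comp (by fun_prop)).enorm
        have h := lintegral_weight_mul_rpow_le (w := fun _ => 1)
          (μ := volume.restrict (Set.Ioc (0 : ℝ) 1)) aemeasurable_const
          (hx.measurable.mul_const ‖y‖ₑ).aemeasurable (by simp) one_le_two
        simp only [one_mul] at h
        exact (ENNReal.rpow_le_rpow (enorm_comp_sub_sub_le hu x y) (by norm_num)).trans h
    _ = ∫⁻ t in Set.Ioc (0 : ℝ) 1, ∫⁻ x,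
          (‖fderiv ℝ u (x - t • y)‖ₑ * ‖y‖ₑ) ^ (2 : ℝ) ∂μ :=
        lintegral_lintegral_swap hm.aemeasurable
    _ = ∫⁻ t in Set.Ioc (0 : ℝ) 1, ‖y‖ₑ ^ (2 : ℝ) * ∫⁻ x, ‖fderiv ℝ u x‖ₑ ^ (2 : ℝ) ∂μ := by
        refine lintegral_congr fun t => ?_
        rw [lintegral_sub_right_eq_self (μ := μ)
          (fun x => (‖fderiv ℝ u x‖ₑ * ‖y‖ₑ) ^ (2 : ℝ)) (t • y)]
        simp only [ENNReal.mul_rpow_of_nonneg _ _ (zero_le_two (α := ℝ))]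
        rw [lintegral_mul_const _ ((hu.continuous_fderiv one_ne_zero).enorm.measurable.pow_const _),
          mul_comm]
    _ = _ := by simp

theorem heatKernel_nonneg (d : ℕ) {ε : ℝ} (hε : 0 < ε) (x : EuclideanSpace ℝ (Fin d)) :
    0 ≤ heatKernel d ε x := by
  unfold heatKernel; positivity

theorem continuous_heatKernel (d : ℕ) (ε : ℝ) : Continuous (heatKernel d ε) := by
  unfold heatKernel; fun_prop

theorem integrable_exp_neg_mul_sq_norm (d : ℕ) {b : ℝ} (hb : 0 < b) :
    Integrable fun x : EuclideanSpace ℝ (Fin d) => Real.exp (-b * ‖x‖ ^ 2) := by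
  refine .of_integral_ne_zero ?_
  rw [GaussianFourier.integral_rexp_neg_mul_sq_norm hb]
  positivity

theorem heatKernel_eq (d : ℕ) (ε : ℝ) (x : EuclideanSpace ℝ (Fin d)) :
    heatKernel d ε x =
      (2 * π * ε) ^ (-(d : ℝ) / 2) * Real.exp (-(1 / (2 * ε)) * ‖x‖ ^ 2) := by
  unfold heatKernel; congr 2; ring

theorem integrable_heatKernel (d : ℕ) {ε : ℝ} (hε : 0 < ε) : Integrable (heatKernel d ε) := by
  rw [funext (heatKernel_eq d ε)]
  exact (integrable_exp_neg_mul_sq_norm d (by positivity)).const_mul _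

theorem integral_heatKernel (d : ℕ) {ε : ℝ} (hε : 0 < ε) : ∫ x, heatKernel d ε x = 1 := by
  simp_rw [heatKernel_eq]
  rw [integral_const_mul, GaussianFourier.integral_rexp_neg_mul_sq_norm (by positivity),
    finrank_euclideanSpace, Fintype.card_fin, neg_div, Real.rpow_neg (by positivity),
    show π / (1 / (2 * ε)) = 2 * π * ε by field_simp]
  exact inv_mul_cancel₀ (by positivity)

theorem lintegral_heatKernel (d : ℕ) {ε : ℝ} (hε : 0 < ε) :
    ∫⁻ x, ENNReal.ofReal (heatKernel d ε x) = 1 := by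
  rw [← ofReal_integral_eq_lintegral_ofReal (integrable_heatKernel d hε)
    (.of_forall (heatKernel_nonneg d hε)), integral_heatKernel d hε, ENNReal.ofReal_one]

theorem rpow_le_mul_exp {s r ε : ℝ} (hs : 0 < s) (hr : 0 ≤ r) (hε : 0 < ε) :
    r ^ s ≤ (2 * s) ^ (s / 2) * ε ^ (s / 2) * Real.exp (1 / (4 * ε) * r ^ 2) := by
  have h1 : r ^ 2 ≤ 2 * s * ε * Real.exp (r ^ 2 / (2 * s * ε)) := by
    have := Real.add_one_le_exp (r ^ 2 / (2 * s * ε))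
    calc r ^ 2 = 2 * s * ε * (r ^ 2 / (2 * s * ε)) := by field_simp
      _ ≤ _ := by gcongr; linarith
  have h2 := Real.rpow_le_rpow (by positivity) h1 (by positivity : 0 ≤ s / 2)
  rw [← Real.rpow_natCast, ← Real.rpow_mul hr, Real.mul_rpow (by positivity) (by positivity),
    Real.mul_rpow (by positivity) (by positivity), ← Real.exp_mul] at h2
  convert h2 using 2
  · push_cast; ring
  · rw [Real.rpow_natCast]
    congr 1
    field_simp
    norm_num
    ring

theorem lintegral_heatKernel_mul_enorm_rpow_le (d : ℕ) {s : ℝ} (hs : 0 < s) {ε : ℝ} (hε : 0 < ε) :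
    ∫⁻ y, ENNReal.ofReal (heatKernel d ε y) * ‖y‖ₑ ^ s ≤
      ENNReal.ofReal ((2 * s) ^ (s / 2) * 2 ^ ((d : ℝ) / 2) * ε ^ (s / 2)) := by
  set A := (2 * π * ε) ^ (-(d : ℝ) / 2) * ((2 * s) ^ (s / 2) * ε ^ (s / 2)) with hA
  have hA0 : 0 ≤ A := by positivity
  have hb : 0 < 1 / (4 * ε) := by positivity
  have hpt : ∀ y : EuclideanSpace ℝ (Fin d), ENNReal.ofReal (heatKernel d ε y) * ‖y‖ₑ ^ s ≤
      ENNReal.ofReal (A * Real.exp (-(1 / (4 * ε)) * ‖y‖ ^ 2)) := by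
    intro y
    rw [← ofReal_norm, ENNReal.ofReal_rpow_of_nonneg (norm_nonneg _) hs.le,
      ← ENNReal.ofReal_mul (heatKernel_nonneg d hε y)]
    refine ENNReal.ofReal_le_ofReal ?_
    refine (mul_le_mul_of_nonneg_left (rpow_le_mul_exp hs (norm_nonneg y) hε)
      (heatKernel_nonneg d hε y)).trans (le_of_eq ?_)
    rw [heatKernel_eq, hA, show -(1 / (4 * ε)) * ‖y‖ ^ 2 =
      -(1 / (2 * ε)) * ‖y‖ ^ 2 + 1 / (4 * ε) * ‖y‖ ^ 2 by field_simp; ring, Real.exp_add]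
    ring
  refine (lintegral_mono hpt).trans (le_of_eq ?_)
  rw [← ofReal_integral_eq_lintegral_ofReal ((integrable_exp_neg_mul_sq_norm d hb).const_mul A)
    (.of_forall fun _ => by positivity), integral_const_mul,
    GaussianFourier.integral_rexp_neg_mul_sq_norm hb, finrank_euclideanSpace, Fintype.card_fin]
  congr 1
  rw [hA, show π / (1 / (4 * ε)) = 2 * (2 * π * ε) by field_simp; ring,
    Real.mul_rpow (x := 2) (y := 2 * π * ε) (by norm_num) (by positivity), neg_div, Real.rpow_neg (by positivity)]
  have : (2 * π * ε) ^ ((d : ℝ) / 2) ≠ 0 := by positivity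
  generalize (2 * π * ε) ^ ((d : ℝ) / 2) = z at this
  field_simp

theorem enorm_heatConv_sub_le (d : ℕ) {ε : ℝ} (hε : 0 < ε) {f : EuclideanSpace ℝ (Fin d) → ℝ}
    (hf : Continuous f) (h2f : HasCompactSupport f) (x : EuclideanSpace ℝ (Fin d)) :
    ‖heatConv d ε f x - f x‖ₑ ≤
      ∫⁻ y, ENNReal.ofReal (heatKernel d ε y) * ‖f (x - y) - f x‖ₑ := by
  have h1 : heatConv d ε f x = ∫ y, heatKernel d ε y * f (x - y) := by
    rw [heatConv, ← integral_sub_left_eq_self _ volume x]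
    simp
  have h2 : f x = ∫ y, heatKernel d ε y * f x := by
    rw [integral_mul_const, integral_heatKernel d hε, one_mul]
  have hi : Integrable fun y => heatKernel d ε y * f (x - y) :=
    ((continuous_heatKernel d ε).mul (hf.comp (by fun_prop))).integrable_of_hasCompactSupport
      (h2f.comp_homeomorph (Homeomorph.subLeft x)).mul_left
  have h3 : heatConv d ε f x - f x =
      ∫ y, (heatKernel d ε y * f (x - y) - heatKernel d ε y * f x) := by
    rw [integral_sub hi ((integrable_heatKernel d hε).mul_const _), ← h1, ← h2]
  rw [h3]
  refine (enorm_integral_le_lintegral_enorm _).trans (lintegral_mono fun y => le_of_eq ?_)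
  rw [← mul_sub, enorm_mul, Real.enorm_eq_ofReal (heatKernel_nonneg d hε y)]

theorem lintegral_sq_comp_sub_sub_sq_le {d : ℕ} {q : ℝ} {C : ℝ≥0}
    (hC : ∀ u : EuclideanSpace ℝ (Fin d) → ℝ, ContDiff ℝ 1 u → HasCompactSupport u →
      ∫⁻ x, ‖u x‖ₑ ^ (2 * q) ≤ C * (∫⁻ x, ‖u x‖ₑ ^ (2 : ℝ)) ^ (q - d * (q - 1) / 2) *
        (∫⁻ x, ‖fderiv ℝ u x‖ₑ ^ (2 : ℝ)) ^ (d * (q - 1) / 2))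
    {s t : ℝ} (hs : s = q - d * (q - 1) / 2) (ht : t = d * (q - 1) / 2) (hs0 : 0 < s) (ht0 : 0 < t)
    {u : EuclideanSpace ℝ (Fin d) → ℝ} (hu : ContDiff ℝ 1 u) (h2u : HasCompactSupport u)
    (y : EuclideanSpace ℝ (Fin d)) :
    ∫⁻ x, ‖u (x - y) ^ 2 - u x ^ 2‖ₑ ^ q ≤
      C * 4 ^ (s / 2 + t) * (∫⁻ x, ‖u x‖ₑ ^ (2 : ℝ)) ^ (s / 2) *
        (∫⁻ x, ‖fderiv ℝ u x‖ₑ ^ (2 : ℝ)) ^ (s / 2 + t) * ‖y‖ₑ ^ s := by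
  have hq0 : 0 < q := by linarith
  set a := ∫⁻ x, ‖u x‖ₑ ^ (2 : ℝ) with ha
  set b := ∫⁻ x, ‖fderiv ℝ u x‖ₑ ^ (2 : ℝ) with hb
  have hv : ContDiff ℝ 1 fun x => u (x - y) := hu.comp (contDiff_id.sub contDiff_const)
  have h2v : HasCompactSupport fun x => u (x - y) :=
    h2u.comp_homeomorph (Homeomorph.subRight y)
  have hdu := fun x => hu.differentiable one_ne_zero x
  have hdv := fun x => hv.differentiable one_ne_zero x
  have hva : ∫⁻ x, ‖u (x - y)‖ₑ ^ (2 : ℝ) = a :=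
    lintegral_sub_right_eq_self (fun x => ‖u x‖ₑ ^ (2 : ℝ)) y
  have hvb : ∫⁻ x, ‖fderiv ℝ u (x - y)‖ₑ ^ (2 : ℝ) = b :=
    lintegral_sub_right_eq_self (fun x => ‖fderiv ℝ u x‖ₑ ^ (2 : ℝ)) y
  have hmb : Measurable fun x => ‖fderiv ℝ u (x - y)‖ₑ :=
    ((hu.continuous_fderiv one_ne_zero).comp (by fun_prop)).enorm.measurable
  have four : ∀ z : ℝ≥0∞, 2 * (z + z) = 4 * z := fun z => by ring
  have hδb : ∫⁻ x, ‖fderiv ℝ (fun x => u (x - y) - u x) x‖ₑ ^ (2 : ℝ) ≤ 4 * b := by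
    refine (lintegral_rpow_two_le_of_le_add hmb (g := fun x => ‖fderiv ℝ u x‖ₑ)
      fun x => ?_).trans (by rw [hvb, four])
    rw [fderiv_fun_sub (hdv x) (hdu x), fderiv_comp_sub]
    exact enorm_sub_le
  have hσb : ∫⁻ x, ‖fderiv ℝ (fun x => u (x - y) + u x) x‖ₑ ^ (2 : ℝ) ≤ 4 * b := by
    refine (lintegral_rpow_two_le_of_le_add hmb (g := fun x => ‖fderiv ℝ u x‖ₑ)
      fun x => ?_).trans (by rw [hvb, four])
    rw [fderiv_fun_add (hdv x) (hdu x), fderiv_comp_sub]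
    exact enorm_add_le (fderiv ℝ u (x - y)) (fderiv ℝ u x)
  have hσa : ∫⁻ x, ‖u (x - y) + u x‖ₑ ^ (2 : ℝ) ≤ 4 * a := by
    refine (lintegral_rpow_two_le_of_le_add hv.continuous.enorm.measurable
      (g := fun x => ‖u x‖ₑ) fun x => ?_).trans (by rw [hva, four])
    exact enorm_add_le _ _
  have hδa := lintegral_enorm_comp_sub_sub_le (μ := volume) hu y
  have hδ := hC _ (hv.sub hu) (by simpa only [sub_eq_add_neg] using! h2v.add h2u.neg)
  have hσ := hC _ (hv.add hu) (h2v.add h2u)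
  rw [← hs, ← ht] at hδ hσ
  grw [hδa, hδb] at hδ
  grw [hσa, hσb] at hσ
  calc ∫⁻ x, ‖u (x - y) ^ 2 - u x ^ 2‖ₑ ^ q
      = ∫⁻ x, ‖u (x - y) - u x‖ₑ ^ q * ‖u (x - y) + u x‖ₑ ^ q := by
        refine lintegral_congr fun x => ?_
        rw [← ENNReal.mul_rpow_of_nonneg _ _ hq0.le, ← enorm_mul]
        ring_nf
    _ ≤ (∫⁻ x, (‖u (x - y) - u x‖ₑ ^ q) ^ (2 : ℝ)) ^ (1 / 2 : ℝ) *
        (∫⁻ x, (‖u (x - y) + u x‖ₑ ^ q) ^ (2 : ℝ)) ^ (1 / 2 : ℝ) :=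
        lintegral_mul_le_sqrt_mul_sqrt
          ((hv.sub hu).continuous.enorm.measurable.pow_const _).aemeasurable
          ((hv.add hu).continuous.enorm.measurable.pow_const _).aemeasurable
    _ ≤ (C * (‖y‖ₑ ^ (2 : ℝ) * b) ^ s * (4 * b) ^ t) ^ (1 / 2 : ℝ) *
        (C * (4 * a) ^ s * (4 * b) ^ t) ^ (1 / 2 : ℝ) := by
        simp_rw [← ENNReal.rpow_mul, mul_comm q 2]
        gcongr
    _ = _ := by
        have hst : 0 ≤ s / 2 := by positivity
        have h12 : (0 : ℝ) ≤ 1 / 2 := by norm_num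
        have split : ∀ z : ℝ≥0∞, z ^ (s / 2 + t) = z ^ (s / 2) * (z ^ (t / 2) * z ^ (t / 2)) := by
          intro z
          rw [← ENNReal.rpow_add_of_nonneg _ _ (by positivity) (by positivity),
            ← ENNReal.rpow_add_of_nonneg _ _ hst (by positivity), add_halves]
        have hCC : (C : ℝ≥0∞) = (C : ℝ≥0∞) ^ (1 / 2 : ℝ) * (C : ℝ≥0∞) ^ (1 / 2 : ℝ) := by
          rw [← ENNReal.rpow_add_of_nonneg _ _ h12 h12]; norm_num
        rw [split, split]
        nth_rewrite 3 [hCC]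
        simp only [ENNReal.mul_rpow_of_nonneg _ _ hs0.le, ENNReal.mul_rpow_of_nonneg _ _ ht0.le,
          ENNReal.mul_rpow_of_nonneg _ _ h12, ← ENNReal.rpow_mul, mul_one_div]
        rw [mul_div_cancel_left₀ s two_ne_zero]
        ring

theorem lintegral_heatConv_sq_sub_sq_le {d : ℕ} (hd : 1 ≤ d) {q : ℝ} (hq : 1 < q)
    (hsub : (d : ℝ) * (q - 1) < 2 * q) {s t : ℝ} (hs : s = q - d * (q - 1) / 2)
    (ht : t = d * (q - 1) / 2) (hs0 : 0 < s) (ht0 : 0 < t) :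
    ∃ K : ℝ, 0 ≤ K ∧ ∀ ε : ℝ, 0 < ε → ∀ u : EuclideanSpace ℝ (Fin d) → ℝ,
      ContDiff ℝ 1 u → HasCompactSupport u →
      ∫⁻ x, ‖heatConv d ε (fun y => u y ^ 2) x - u x ^ 2‖ₑ ^ q ≤
        ENNReal.ofReal (K * ε ^ (s / 2)) * (∫⁻ x, ‖u x‖ₑ ^ (2 : ℝ)) ^ (s / 2) *
        (∫⁻ x, ‖fderiv ℝ u x‖ₑ ^ (2 : ℝ)) ^ (s / 2 + t) := by
  obtain ⟨C, hC⟩ := gagliardoNirenberg hd hq hsub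
  refine ⟨C * 4 ^ (s / 2 + t) * ((2 * s) ^ (s / 2) * 2 ^ ((d : ℝ) / 2)), by positivity,
    fun ε hε u hu h2u => ?_⟩
  have hq0 : 0 < q := by linarith
  set a := ∫⁻ x, ‖u x‖ₑ ^ (2 : ℝ) with ha
  set b := ∫⁻ x, ‖fderiv ℝ u x‖ₑ ^ (2 : ℝ) with hb
  have hw : Measurable fun y => ENNReal.ofReal (heatKernel d ε y) :=
    (continuous_heatKernel d ε).measurable.ennreal_ofReal
  have hcu := hu.continuous
  have hG : Measurable fun p : EuclideanSpace ℝ (Fin d) × EuclideanSpace ℝ (Fin d) =>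
      ‖u (p.1 - p.2) ^ 2 - u p.1 ^ 2‖ₑ ^ q :=
    ((by fun_prop : Continuous fun p : EuclideanSpace ℝ (Fin d) × EuclideanSpace ℝ (Fin d) =>
      u (p.1 - p.2) ^ 2 - u p.1 ^ 2).enorm.measurable.pow_const q)
  calc ∫⁻ x, ‖heatConv d ε (fun y => u y ^ 2) x - u x ^ 2‖ₑ ^ q
      ≤ ∫⁻ x, ∫⁻ y, ENNReal.ofReal (heatKernel d ε y) * ‖u (x - y) ^ 2 - u x ^ 2‖ₑ ^ q := by
        refine lintegral_mono fun x => ?_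
        refine (ENNReal.rpow_le_rpow (enorm_heatConv_sub_le d hε (hu.pow 2).continuous
          (hasCompactSupport_pow h2u 1) x) hq0.le).trans ?_
        exact lintegral_weight_mul_rpow_le hw.aemeasurable
          (by fun_prop : Continuous fun y => u (x - y) ^ 2 - u x ^ 2).enorm.aemeasurable
          (lintegral_heatKernel d hε) hq.le
    _ = ∫⁻ y, ∫⁻ x, ENNReal.ofReal (heatKernel d ε y) * ‖u (x - y) ^ 2 - u x ^ 2‖ₑ ^ q :=
        lintegral_lintegral_swap ((hw.comp measurable_snd).mul hG).aemeasurable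
    _ ≤ ∫⁻ y, C * 4 ^ (s / 2 + t) * a ^ (s / 2) * b ^ (s / 2 + t) *
          (ENNReal.ofReal (heatKernel d ε y) * ‖y‖ₑ ^ s) := by
        refine lintegral_mono fun y => ?_
        rw [lintegral_const_mul' _ _ ENNReal.ofReal_ne_top, mul_left_comm]
        gcongr
        exact lintegral_sq_comp_sub_sub_sq_le hC hs ht hs0 ht0 hu h2u y
    _ ≤ C * 4 ^ (s / 2 + t) * a ^ (s / 2) * b ^ (s / 2 + t) *
          ENNReal.ofReal ((2 * s) ^ (s / 2) * 2 ^ ((d : ℝ) / 2) * ε ^ (s / 2)) := by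
        rw [lintegral_const_mul (f := fun y => ENNReal.ofReal (heatKernel d ε y) * ‖y‖ₑ ^ s) _
          (hw.mul (measurable_enorm.pow_const s))]
        gcongr
        exact lintegral_heatKernel_mul_enorm_rpow_le d hs0 hε
    _ = _ := by
        rw [mul_assoc ((C : ℝ) * _) (_ * _) (ε ^ (s / 2)), ENNReal.ofReal_mul (p := (C : ℝ) * _) (by positivity),
          ENNReal.ofReal_mul (NNReal.coe_nonneg C), ENNReal.ofReal_coe_nnreal,
          ← ENNReal.ofReal_rpow_of_pos (by norm_num : (0 : ℝ) < 4), ENNReal.ofReal_ofNat]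
        ring

theorem lintegral_enorm_rpow_two_eq {d : ℕ} {F : Type*} [NormedAddCommGroup F]
    {f : EuclideanSpace ℝ (Fin d) → F} (hf : Continuous f) (h2f : HasCompactSupport f) :
    ∫⁻ x, ‖f x‖ₑ ^ (2 : ℝ) = ENNReal.ofReal (∫ x, ‖f x‖ ^ 2) := by
  have h2 : HasCompactSupport fun x => ‖f x‖ ^ 2 := by
    simpa only [one_add_one_eq_two] using hasCompactSupport_pow h2f.norm 1
  have hi : Integrable fun x => ‖f x‖ ^ 2 :=
    (hf.norm.pow 2).integrable_of_hasCompactSupport h2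
  rw [ofReal_integral_eq_lintegral_ofReal hi (.of_forall fun _ => by positivity)]
  refine lintegral_congr fun x => ?_
  rw [← ofReal_norm, ENNReal.ofReal_rpow_of_nonneg (norm_nonneg _) (by norm_num)]
  norm_num

theorem integral_abs_rpow_le_toReal {α : Type*} [MeasurableSpace α] {μ : Measure α} {f : α → ℝ}
    {q : ℝ} (hq : 0 ≤ q) {N : ℝ≥0∞} (hN : N ≠ ∞) (h : ∫⁻ x, ‖f x‖ₑ ^ q ∂μ ≤ N) :
    ∫ x, |f x| ^ q ∂μ ≤ N.toReal := by
  by_cases hi : Integrable (fun x => |f x| ^ q) μ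
  · rw [← ENNReal.ofReal_le_iff_le_toReal hN,
      ofReal_integral_eq_lintegral_ofReal hi (.of_forall fun _ => by positivity)]
    refine le_trans (le_of_eq (lintegral_congr fun x => ?_)) h
    rw [← ofReal_norm, ENNReal.ofReal_rpow_of_nonneg (norm_nonneg _) hq, Real.norm_eq_abs]
  · rw [integral_undef hi]
    exact ENNReal.toReal_nonneg

theorem smoothing_Lq_bound (d : ℕ) (hd : 1 ≤ d) (q : ℝ) (hq : 1 < q)
    (hsub : (d : ℝ) * (q - 1) < 2 * q) :
    ∃ θ : ℝ, θ ∈ Set.Ioo (0 : ℝ) 1 ∧ ∃ C : ℝ, 0 < C ∧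
      ∀ ε : ℝ, 0 < ε → ∀ ψ : EuclideanSpace ℝ (Fin d) → ℝ,
        ContDiff ℝ 1 ψ → HasCompactSupport ψ →
          Lnorm d q (fun x => heatConv d ε (fun y => ψ y ^ 2) x - ψ x ^ 2) ≤
              C * ε ^ (θ / 2) * gradNorm2 d ψ ^ (2 - θ) * Lnorm d 2 ψ ^ θ ∧
          Lnorm d q (fun x => heatConv d ε (fun y => ψ y ^ 2) x - ψ x ^ 2) ≤
              C * ε ^ (θ / 2) * (gradNorm2 d ψ ^ 2 + Lnorm d 2 ψ ^ 2) := by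
  have hq0 : 0 < q := by linarith
  have hd0 : (0 : ℝ) < d := by exact_mod_cast hd
  obtain ⟨t, ht⟩ : ∃ t : ℝ, t = d * (q - 1) / 2 := ⟨_, rfl⟩
  obtain ⟨s, hs⟩ : ∃ s : ℝ, s = q - d * (q - 1) / 2 := ⟨_, rfl⟩
  have hq1 : 0 < q - 1 := by linarith
  have ht0 : 0 < t := by rw [ht]; positivity
  have hs0 : 0 < s := by linarith
  have hst : s + t = q := by linarith
  obtain ⟨K, hK0, hK⟩ := lintegral_heatConv_sq_sub_sq_le hd hq hsub hs ht hs0 ht0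
  have hθ1 : s / q < 1 := (div_lt_one hq0).2 (by linarith)
  have hθ0 : 0 < s / q := by positivity
  refine ⟨s / q, ⟨hθ0, hθ1⟩, K ^ (1 / q) + 1, by positivity, fun ε hε ψ hψ h2ψ => ?_⟩
  set θ := s / q with hθ
  set A := ∫ x, ‖ψ x‖ ^ 2 with hA
  set B := ∫ x, ‖fderiv ℝ ψ x‖ ^ 2 with hB
  have hA0 : 0 ≤ A := integral_nonneg fun _ => by positivity
  have hB0 : 0 ≤ B := integral_nonneg fun _ => by positivity
  have hgrad : gradNorm2 d ψ = B ^ (1 / 2 : ℝ) := rfl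
  have hL2 : Lnorm d 2 ψ = A ^ (1 / 2 : ℝ) := by
    simp [Lnorm, hA]
  have hmain := hK ε hε ψ hψ h2ψ
  rw [lintegral_enorm_rpow_two_eq hψ.continuous h2ψ,
    lintegral_enorm_rpow_two_eq (hψ.continuous_fderiv one_ne_zero) (h2ψ.fderiv ℝ), ← hA, ← hB,
    ENNReal.ofReal_rpow_of_nonneg hA0 (by positivity),
    ENNReal.ofReal_rpow_of_nonneg hB0 (by positivity), ← ENNReal.ofReal_mul (by positivity),
    ← ENNReal.ofReal_mul (by positivity)] at hmain
  have hint := integral_abs_rpow_le_toReal hq0.le ENNReal.ofReal_ne_top hmain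
  rw [ENNReal.toReal_ofReal (by positivity)] at hint
  have hfirst : Lnorm d q (fun x => heatConv d ε (fun y => ψ y ^ 2) x - ψ x ^ 2) ≤
      (K ^ (1 / q) + 1) * ε ^ (θ / 2) * gradNorm2 d ψ ^ (2 - θ) * Lnorm d 2 ψ ^ θ := by
    calc _ ≤ (K * ε ^ (s / 2) * A ^ (s / 2) * B ^ (s / 2 + t)) ^ (1 / q) :=
          Real.rpow_le_rpow (integral_nonneg fun _ => by positivity) hint (by positivity)
      _ = K ^ (1 / q) * ε ^ (θ / 2) * gradNorm2 d ψ ^ (2 - θ) * Lnorm d 2 ψ ^ θ := by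
          rw [Real.mul_rpow (by positivity) (by positivity),
            Real.mul_rpow (by positivity) (by positivity),
            Real.mul_rpow (by positivity) (by positivity), hgrad, hL2,
            ← Real.rpow_mul hε.le, ← Real.rpow_mul hA0, ← Real.rpow_mul hB0,
            ← Real.rpow_mul hA0, ← Real.rpow_mul hB0,
            show s / 2 * (1 / q) = θ / 2 by rw [hθ]; ring,
            show (s / 2 + t) * (1 / q) = 1 / 2 * (2 - θ) by
              rw [hθ, show t = q - s by linarith]; field_simp; ring,
            show θ / 2 = 1 / 2 * θ by ring]
          ring
      _ ≤ _ := by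
          have : 0 ≤ gradNorm2 d ψ := by rw [hgrad]; positivity
          have : 0 ≤ Lnorm d 2 ψ := by rw [hL2]; positivity
          gcongr
          linarith
  refine ⟨hfirst, hfirst.trans ?_⟩
  have hg0 : 0 ≤ gradNorm2 d ψ := by rw [hgrad]; positivity
  have hl0 : 0 ≤ Lnorm d 2 ψ := by rw [hL2]; positivity
  rw [mul_assoc]
  gcongr
  have hy := Real.geom_mean_le_arith_mean2_weighted (w₁ := 1 - θ / 2) (w₂ := θ / 2)
    (by linarith) (by linarith) (sq_nonneg (gradNorm2 d ψ)) (sq_nonneg (Lnorm d 2 ψ)) (by ring)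
  rw [← Real.rpow_natCast, ← Real.rpow_natCast, ← Real.rpow_mul hg0, ← Real.rpow_mul hl0] at hy
  rw [show ((2 : ℕ) : ℝ) * (1 - θ / 2) = 2 - θ by push_cast; ring,
    show ((2 : ℕ) : ℝ) * (θ / 2) = θ by push_cast; ring, Real.rpow_natCast,
    Real.rpow_natCast] at hy
  nlinarith [sq_nonneg (gradNorm2 d ψ), sq_nonneg (Lnorm d 2 ψ)]
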